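/- For V, W ∈ ℍ with real components V = a + b·i + c·j + d·k, W = x + y·i + z·j + w·k, the four equations bx − ay = 0, dz − cw = 0, bz − cy = 0, dx − aw = 0 hold simultaneously if and only if V and W are linearly dependent over ℝ, or span_ℝ{V, W} = span_ℝ{1, j}, or span_ℝ{V, W} = span_ℝ{i, k}. -/

import Mathlib

open scoped Quaternion

noncomputable section

/-- The quaternion `i`. -/
def qi : ℍ := ⟨0, 1, 0, 0⟩

/-- The quaternion `j`. -/
def qj : ℍ := ⟨0, 0, 1, 0⟩

/-- The quaternion `k`. -/
def qk : ℍ := ⟨0, 0, 0, 1⟩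

/-- An invertible change of basis does not change the span of two vectors. -/
theorem span_pair_eq_of_det_ne_zero {K M : Type*} [Field K] [AddCommGroup M] [Module K M]
    {p q v u : M} {a c x z : K} (hv : v = a • p + c • q) (hu : u = x • p + z • q)
    (h : a * z - c * x ≠ 0) :
    Submodule.span K ({v, u} : Set M) = Submodule.span K ({p, q} : Set M) := by
  apply le_antisymm <;> rw [Submodule.span_le, Set.pair_subset_iff] <;>
    simp only [SetLike.mem_coe, Submodule.mem_span_pair]
  · exact ⟨⟨a, c, hv.symm⟩, ⟨x, z, hu.symm⟩⟩
  · subst hv hu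
    have hinv := inv_mul_cancel₀ h
    refine ⟨⟨(a * z - c * x)⁻¹ * z, -((a * z - c * x)⁻¹ * c), ?_⟩,
      ⟨-((a * z - c * x)⁻¹ * x), (a * z - c * x)⁻¹ * a, ?_⟩⟩ <;>
    · match_scalars <;> first | ring1 | linear_combination hinv

@[simp] theorem qi_re : qi.re = 0 := rfl

@[simp] theorem qi_imI : qi.imI = 1 := rfl

@[simp] theorem qi_imJ : qi.imJ = 0 := rfl

@[simp] theorem qi_imK : qi.imK = 0 := rfl

@[simp] theorem qj_re : qj.re = 0 := rfl

@[simp] theorem qj_imI : qj.imI = 0 := rfl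

@[simp] theorem qj_imJ : qj.imJ = 1 := rfl

@[simp] theorem qj_imK : qj.imK = 0 := rfl

@[simp] theorem qk_re : qk.re = 0 := rfl

@[simp] theorem qk_imI : qk.imI = 0 := rfl

@[simp] theorem qk_imJ : qk.imJ = 0 := rfl

@[simp] theorem qk_imK : qk.imK = 1 := rfl

theorem components_of_eq_basis_expansion {a b c d : ℝ} {V : ℍ}
    (hV : V = (a : ℍ) + b • qi + c • qj + d • qk) :
    V.re = a ∧ V.imI = b ∧ V.imJ = c ∧ V.imK = d := by
  simp [hV]

theorem smul_add_smul_eq_zero_iff (s t : ℝ) (V W : ℍ) :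
    s • V + t • W = 0 ↔ s * V.re + t * W.re = 0 ∧ s * V.imI + t * W.imI = 0 ∧
      s * V.imJ + t * W.imJ = 0 ∧ s * V.imK + t * W.imK = 0 := by
  simp [Quaternion.ext_iff]

/-- Two quaternions are linearly dependent when all `2 × 2` minors of their components vanish. -/
theorem not_linearIndependent_of_minors_eq_zero {V W : ℍ}
    (h01 : V.imI * W.re - V.re * W.imI = 0) (h23 : V.imK * W.imJ - V.imJ * W.imK = 0)
    (h12 : V.imI * W.imJ - V.imJ * W.imI = 0) (h03 : V.imK * W.re - V.re * W.imK = 0)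
    (h02 : V.re * W.imJ - V.imJ * W.re = 0) (h13 : V.imI * W.imK - V.imK * W.imI = 0) :
    ¬ LinearIndependent ℝ ![V, W] := by
  simp only [LinearIndependent.pair_iff, smul_add_smul_eq_zero_iff]
  intro h
  have ha := (h W.re (-V.re) (by refine ⟨?_, ?_, ?_, ?_⟩ <;> linarith)).2
  have hb := (h W.imI (-V.imI) (by refine ⟨?_, ?_, ?_, ?_⟩ <;> linarith)).2
  have hc := (h W.imJ (-V.imJ) (by refine ⟨?_, ?_, ?_, ?_⟩ <;> linarith)).2
  have hd := (h W.imK (-V.imK) (by refine ⟨?_, ?_, ?_, ?_⟩ <;> linarith)).2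
  exact one_ne_zero (h 1 0 (by refine ⟨?_, ?_, ?_, ?_⟩ <;> linarith)).1

/-- Proportional pairs have vanishing determinant. -/
theorem det_eq_zero_of_dependent {s t a b x y : ℝ} (hst : ¬ (s = 0 ∧ t = 0))
    (h₁ : s * a + t * x = 0) (h₂ : s * b + t * y = 0) : b * x - a * y = 0 := by
  by_cases hs : s = 0
  · have ht : t ≠ 0 := fun ht => hst ⟨hs, ht⟩
    refine (mul_eq_zero.mp ?_).resolve_left ht
    linear_combination b * h₁ - a * h₂
  · refine (mul_eq_zero.mp ?_).resolve_left hs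
    linear_combination x * h₂ - y * h₁

/-- A pair proportional to both columns of an invertible `2 × 2` matrix vanishes. -/
theorem eq_zero_of_det_ne_zero {a c x z b y : ℝ} (h : a * z - c * x ≠ 0)
    (h₁ : b * x - a * y = 0) (h₂ : b * z - c * y = 0) : b = 0 ∧ y = 0 := by
  constructor <;> refine (mul_eq_zero.mp ?_).resolve_left h
  · linear_combination a * h₂ - c * h₁
  · linear_combination x * h₂ - z * h₁

theorem imI_imK_eq_zero_of_mem_span {V : ℍ}
    (h : V ∈ Submodule.span ℝ ({1, qj} : Set ℍ)) : V.imI = 0 ∧ V.imK = 0 := by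
  obtain ⟨s, t, rfl⟩ := Submodule.mem_span_pair.mp h
  simp

theorem re_imJ_eq_zero_of_mem_span {V : ℍ}
    (h : V ∈ Submodule.span ℝ ({qi, qk} : Set ℍ)) : V.re = 0 ∧ V.imJ = 0 := by
  obtain ⟨s, t, rfl⟩ := Submodule.mem_span_pair.mp h
  simp

/-- The equations `bx − ay = dz − cw = bz − cy = dx − aw = 0` hold iff `V, W` are linearly
dependent, or `span{V,W} = span{1,j}`, or `span{V,W} = span{i,k}`. -/
theorem stmt_12 (a b c d x y z w : ℝ) (V W : ℍ)
    (hV : V = (a : ℍ) + b • qi + c • qj + d • qk)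
    (hW : W = (x : ℍ) + y • qi + z • qj + w • qk) :
    (b*x - a*y = 0 ∧ d*z - c*w = 0 ∧ b*z - c*y = 0 ∧ d*x - a*w = 0) ↔
      (¬ LinearIndependent ℝ ![V, W] ∨
        Submodule.span ℝ ({V, W} : Set ℍ) = Submodule.span ℝ ({1, qj} : Set ℍ) ∨
        Submodule.span ℝ ({V, W} : Set ℍ) = Submodule.span ℝ ({qi, qk} : Set ℍ)) := by
  obtain ⟨rfl, rfl, rfl, rfl⟩ := components_of_eq_basis_expansion hV
  obtain ⟨rfl, rfl, rfl, rfl⟩ := components_of_eq_basis_expansion hW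
  clear hV hW
  constructor
  · rintro ⟨h01, h23, h12, h03⟩
    by_cases h02 : V.re * W.imJ - V.imJ * W.re = 0
    · by_cases h13 : V.imI * W.imK - V.imK * W.imI = 0
      · exact Or.inl (not_linearIndependent_of_minors_eq_zero h01 h23 h12 h03 h02 h13)
      · obtain ⟨hVr, hWr⟩ := eq_zero_of_det_ne_zero (b := V.re) (y := W.re) h13
          (by linarith) (by linarith)
        obtain ⟨hVj, hWj⟩ := eq_zero_of_det_ne_zero (b := V.imJ) (y := W.imJ) h13
          (by linarith) (by linarith)
        refine Or.inr (Or.inr (span_pair_eq_of_det_ne_zero ?_ ?_ h13)) <;>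
          ext <;> simp [*]
    · obtain ⟨hVi, hWi⟩ := eq_zero_of_det_ne_zero h02 h01 h12
      obtain ⟨hVk, hWk⟩ := eq_zero_of_det_ne_zero h02 h03 (by linarith)
      refine Or.inr (Or.inl (span_pair_eq_of_det_ne_zero ?_ ?_ h02)) <;>
        ext <;> simp [*]
  · have hVs : V ∈ Submodule.span ℝ ({V, W} : Set ℍ) := Submodule.mem_span_of_mem (by simp)
    have hWs : W ∈ Submodule.span ℝ ({V, W} : Set ℍ) := Submodule.mem_span_of_mem (by simp)
    rintro (h | h | h)
    · simp only [LinearIndependent.pair_iff, smul_add_smul_eq_zero_iff, not_forall] at h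
      obtain ⟨s, t, ⟨h0, h1, h2, h3⟩, hst⟩ := h
      exact ⟨det_eq_zero_of_dependent hst h0 h1, det_eq_zero_of_dependent hst h2 h3,
        det_eq_zero_of_dependent hst h2 h1, det_eq_zero_of_dependent hst h0 h3⟩
    · rw [h] at hVs hWs
      simp [imI_imK_eq_zero_of_mem_span hVs, imI_imK_eq_zero_of_mem_span hWs]
    · rw [h] at hVs hWs
      simp [re_imJ_eq_zero_of_mem_span hVs, re_imJ_eq_zero_of_mem_span hWs]
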